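/- arXiv:1112.2992 — 3 statements merged into one kernel-verified Lean document; each statement's English description precedes it below -/
import Mathlib

section
/- Let C be a k-bialgebra and D a coassociative counital k-coalgebra. Let φ : C⊗D → k be a convolution-invertible linear functional with convolution inverse φ⁻¹, and suppose that the map λ_φ : C⊗D → D, λ_φ(c⊗d) := φ(c⊗d₍₂₎) d₍₁₎, is a left action of C on D, i.e. λ_φ(c' ⊗ λ_φ(c⊗d)) = λ_φ(c'c ⊗ d) and λ_φ(1_C ⊗ d) = d for all c, c' ∈ C, d ∈ D. Define Δ_{φ⁻¹} : C⊗D → (C⊗D)⊗(C⊗D) by Δ_{φ⁻¹}(c⊗d) = φ⁻¹(c₍₂₎⊗d₍₂₎) (c₍₁₎⊗d₍₁₎)⊗(c₍₃₎⊗d₍₃₎). Then (λ_φ⊗λ_φ)∘Δ_{φ⁻¹} = Δ_D∘λ_φ and ε_D∘λ_φ = φ; that is, λ_φ is a coalgebra map from (C⊗D, Δ_{φ⁻¹}, φ) to (D, Δ_D, ε_D). -/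
open TensorProduct LinearMap

noncomputable section
namespace TwistedTensor

def cmul (k C : Type*) [CommSemiring k] [AddCommMonoid C] [Module k C] [Coalgebra k C] :
    C →ₗ[k] C ⊗[k] C := Coalgebra.comul

def eps (k C : Type*) [CommSemiring k] [AddCommMonoid C] [Module k C] [Coalgebra k C] :
    C →ₗ[k] k := Coalgebra.counit

variable {k : Type*} [Field k]
variable {C : Type*} [Ring C] [Bialgebra k C]
variable {D : Type*} [AddCommGroup D] [Module k D] [Coalgebra k D]

/-- The tensor counit `ε_⊗ = ε_C ⊗ ε_D`. -/
def tensorCounit : C ⊗[k] D →ₗ[k] k :=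
  (TensorProduct.lid k k).toLinearMap ∘ₗ map (eps k C) (eps k D)

/-- Convolution product on `(C⊗D)'`: `(φ∗φ')(c⊗d) = φ(c₁⊗d₁)φ'(c₂⊗d₂)`. -/
def convMul (φ φ' : C ⊗[k] D →ₗ[k] k) : C ⊗[k] D →ₗ[k] k :=
  (TensorProduct.lid k k).toLinearMap ∘ₗ map φ φ'
    ∘ₗ (tensorTensorTensorComm k C C D D).toLinearMap
    ∘ₗ map (cmul k C) (cmul k D)

/-- The map `λ_φ : C⊗D → D`, `λ_φ(c⊗d) = φ(c⊗d₂) d₁`. -/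
def lam (φ : C ⊗[k] D →ₗ[k] k) : C ⊗[k] D →ₗ[k] D :=
  (TensorProduct.lid k D).toLinearMap ∘ₗ rTensor D φ
    ∘ₗ (TensorProduct.assoc k C D D).symm.toLinearMap
    ∘ₗ lTensor C (TensorProduct.comm k D D).toLinearMap
    ∘ₗ lTensor C (cmul k D)

/-- The iterated coproduct `c ↦ c₁⊗c₂⊗c₃`. -/
def cmul3 (k C : Type*) [CommSemiring k] [AddCommMonoid C] [Module k C] [Coalgebra k C] :
    C →ₗ[k] (C ⊗[k] C) ⊗[k] C := rTensor C (cmul k C) ∘ₗ cmul k C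

/-- The coproduct `Δ_{φ⁻¹}(c⊗d) = φ⁻¹(c₂⊗d₂) (c₁⊗d₁)⊗(c₃⊗d₃)`. -/
def deltaFun (φi : C ⊗[k] D →ₗ[k] k) :
    C ⊗[k] D →ₗ[k] (C ⊗[k] D) ⊗[k] (C ⊗[k] D) :=
  rTensor (C ⊗[k] D)
      ((TensorProduct.rid k (C ⊗[k] D)).toLinearMap ∘ₗ lTensor (C ⊗[k] D) φi)
    ∘ₗ rTensor (C ⊗[k] D) (tensorTensorTensorComm k C C D D).toLinearMap
    ∘ₗ (tensorTensorTensorComm k (C ⊗[k] C) C (D ⊗[k] D) D).toLinearMap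
    ∘ₗ map (cmul3 k C) (cmul3 k D)

lemma lam_tmul (φ : C ⊗[k] D →ₗ[k] k) (c : C) {d : D} {ι : Type*} (r : Coalgebra.Repr k d ι) :
    lam φ (c ⊗ₜ[k] d) = ∑ i ∈ r.index, φ (c ⊗ₜ[k] r.right i) • r.left i := by
  simp [lam, cmul, ← r.eq, tmul_sum]

lemma convMul_tmul (φ φ' : C ⊗[k] D →ₗ[k] k) {c : C} {d : D} {ι κ : Type*}
    (rc : Coalgebra.Repr k c κ) (rd : Coalgebra.Repr k d ι) :
    convMul φ φ' (c ⊗ₜ[k] d) = ∑ j ∈ rc.index, ∑ i ∈ rd.index,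
      φ (rc.left j ⊗ₜ[k] rd.left i) * φ' (rc.right j ⊗ₜ[k] rd.right i) := by
  simp [convMul, cmul, ← rc.eq, ← rd.eq, tmul_sum, sum_tmul]
  exact Finset.sum_comm

/-- The map `c⊗d ↦ φ'(c₂⊗d₂) λ_φ(c₁⊗d₁)`. -/
def lamConv (φ φ' : C ⊗[k] D →ₗ[k] k) : C ⊗[k] D →ₗ[k] D :=
  (TensorProduct.rid k D).toLinearMap ∘ₗ map (lam φ) φ'
    ∘ₗ (tensorTensorTensorComm k C C D D).toLinearMap
    ∘ₗ map (cmul k C) (cmul k D)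

lemma lamConv_tmul (φ φ' : C ⊗[k] D →ₗ[k] k) {c : C} {d : D} {ι κ : Type*}
    (rc : Coalgebra.Repr k c κ) (rd : Coalgebra.Repr k d ι) :
    lamConv φ φ' (c ⊗ₜ[k] d) = ∑ j ∈ rc.index, ∑ i ∈ rd.index,
      φ' (rc.right j ⊗ₜ[k] rd.right i) • lam φ (rc.left j ⊗ₜ[k] rd.left i) := by
  simp [lamConv, cmul, ← rc.eq, ← rd.eq, tmul_sum, sum_tmul]
  exact Finset.sum_comm

open Coalgebra in
lemma lamConv_eq_lam_convMul (φ φ' : C ⊗[k] D →ₗ[k] k) :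
    lamConv φ φ' = lam (convMul φ φ') := by
  ext c d
  have key (a b : C) := congrArg
    ((TensorProduct.rid k D).toLinearMap ∘ₗ lTensor D (TensorProduct.lid k k).toLinearMap)
    (congrArg (map .id (map (φ ∘ₗ TensorProduct.mk k C D a) (φ' ∘ₗ TensorProduct.mk k C D b)))
      (sum_tmul_tmul_eq (ℛ k d) (fun i ↦ ℛ k ((ℛ k d).left i)) (fun i ↦ ℛ k ((ℛ k d).right i))))
  simp only [map_sum, map_tmul, coe_comp, Function.comp_apply, LinearEquiv.coe_coe, lTensor_tmul,
    lid_tmul, rid_tmul, id_apply, mk_apply, smul_eq_mul] at key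
  simp only [AlgebraTensorModule.curry_apply, restrictScalars_self, curry_apply]
  rw [lamConv_tmul φ φ' (ℛ k c) (ℛ k d), lam_tmul _ _ (ℛ k d)]
  simp only [lam_tmul φ _ (ℛ k ((ℛ k d).left _)),
    convMul_tmul φ φ' (ℛ k c) (ℛ k ((ℛ k d).right _)), Finset.sum_smul, Finset.smul_sum, smul_smul]
  rw [Finset.sum_comm (s := (ℛ k d).index) (t := (ℛ k c).index)]
  refine Finset.sum_congr rfl fun j _ ↦ ?_
  rw [← key]
  simp only [mul_comm]

open Coalgebra in
lemma lam_tensorCounit (c : C) (d : D) :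
    lam (tensorCounit (k := k)) (c ⊗ₜ[k] d) = counit (R := k) c • d := by
  rw [lam_tmul _ _ (ℛ k d)]
  simp only [tensorCounit, eps, coe_comp, Function.comp_apply, LinearEquiv.coe_coe, map_tmul,
    lid_tmul, smul_eq_mul, ← smul_smul, ← Finset.smul_sum]
  congr 1
  simpa only [map_sum, rid_tmul, one_smul] using
    congrArg (TensorProduct.rid k D) (sum_tmul_counit_eq (ℛ k d))

lemma map_lam_comp_deltaFun (φ φ' : C ⊗[k] D →ₗ[k] k) :
    map (lam φ) (lam φ) ∘ₗ deltaFun φ' = map (lamConv φ φ') (lam φ)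
      ∘ₗ (tensorTensorTensorComm k C C D D).toLinearMap ∘ₗ map (cmul k C) (cmul k D) := by
  have h : map (lam φ) (lam φ) ∘ₗ rTensor (C ⊗[k] D)
      ((TensorProduct.rid k (C ⊗[k] D)).toLinearMap ∘ₗ lTensor (C ⊗[k] D) φ')
      = map ((TensorProduct.rid k D).toLinearMap ∘ₗ map (lam φ) φ') (lam φ) := by
    ext; simp
  have h' : map (cmul3 k C) (cmul3 k D) = map (rTensor C (cmul k C)) (rTensor D (cmul k D)) ∘ₗ
      map (cmul k C) (cmul k D) := by
    rw [← map_comp]; rfl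
  have h'' : (tensorTensorTensorComm k (C ⊗[k] C) C (D ⊗[k] D) D).toLinearMap ∘ₗ
      map (rTensor C (cmul k C)) (rTensor D (cmul k D)) =
      rTensor (C ⊗[k] D) (map (cmul k C) (cmul k D)) ∘ₗ
        (tensorTensorTensorComm k C C D D).toLinearMap := by
    ext; simp
  rw [deltaFun, h', ← LinearMap.comp_assoc, h,
    ← LinearMap.comp_assoc (map (cmul k C) (cmul k D)), h'']
  simp only [lamConv, ← LinearMap.comp_assoc, map_comp_rTensor]

open Coalgebra in
lemma map_lam_comp_deltaFun_of_convMul_eq (φ φ' : C ⊗[k] D →ₗ[k] k)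
    (h : convMul φ φ' = tensorCounit) :
    map (lam φ) (lam φ) ∘ₗ deltaFun φ' = cmul k D ∘ₗ lam φ := by
  rw [map_lam_comp_deltaFun, lamConv_eq_lam_convMul, h]
  ext c d
  have key := congrArg
    (lTensor D ((TensorProduct.rid k D).toLinearMap ∘ₗ lTensor D (φ ∘ₗ TensorProduct.mk k C D c)))
      (sum_tmul_tmul_eq (ℛ k d) (fun i ↦ ℛ k ((ℛ k d).left i)) (fun i ↦ ℛ k ((ℛ k d).right i)))
  simp only [map_sum, coe_comp, Function.comp_apply, LinearEquiv.coe_coe, lTensor_tmul,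
    rid_tmul, mk_apply] at key
  have hc (x : D) : lam φ (c ⊗ₜ[k] x) =
      ∑ j ∈ (ℛ k c).index, counit (R := k) ((ℛ k c).left j) • lam φ ((ℛ k c).right j ⊗ₜ[k] x) := by
    conv_lhs => rw [← sum_counit_smul (ℛ k c)]
    simp only [sum_tmul, map_sum, ← smul_tmul', map_smul]
  trans ∑ i ∈ (ℛ k d).index, (ℛ k d).left i ⊗ₜ[k] lam φ (c ⊗ₜ[k] (ℛ k d).right i)
  · simp only [hc, AlgebraTensorModule.curry_apply, restrictScalars_self, curry_apply, coe_comp,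
      Function.comp_apply, map_tmul, cmul, ← (ℛ k d).eq]
    conv_lhs => rw [← (ℛ k c).eq]
    simp [tmul_sum, sum_tmul, lam_tensorCounit, smul_tmul]
  · simp only [AlgebraTensorModule.curry_apply, restrictScalars_self, curry_apply, coe_comp,
      Function.comp_apply]
    rw [lam_tmul _ _ (ℛ k d)]
    simp only [lam_tmul φ c (ℛ k ((ℛ k d).right _)), tmul_sum]
    rw [← key]
    simp only [map_sum, map_smul, cmul]
    refine Finset.sum_congr rfl fun i _ ↦ ?_
    rw [← (ℛ k ((ℛ k d).left i)).eq]
    simp [Finset.smul_sum]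

open Coalgebra in
lemma eps_comp_lam (φ : C ⊗[k] D →ₗ[k] k) : eps k D ∘ₗ lam φ = φ := by
  ext c d
  simp only [AlgebraTensorModule.curry_apply, restrictScalars_self, curry_apply, coe_comp,
    Function.comp_apply]
  rw [lam_tmul _ _ (ℛ k d)]
  conv_rhs => rw [← sum_counit_smul (ℛ k d)]
  simp [eps, tmul_sum, mul_comm]

theorem stmt16 (φ φi : C ⊗[k] D →ₗ[k] k)
    (hinv1 : convMul φ φi = tensorCounit) (hinv2 : convMul φi φ = tensorCounit)
    (hact : ∀ (c c' : C) (d : D),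
      lam φ (c' ⊗ₜ[k] lam φ (c ⊗ₜ[k] d)) = lam φ ((c' * c) ⊗ₜ[k] d))
    (hunit : ∀ d : D, lam φ ((1 : C) ⊗ₜ[k] d) = d) :
    map (lam φ) (lam φ) ∘ₗ deltaFun φi = cmul k D ∘ₗ lam φ ∧
    eps k D ∘ₗ lam φ = φ := by
  exact ⟨map_lam_comp_deltaFun_of_convMul_eq φ φi hinv1, eps_comp_lam φ⟩

end TwistedTensor
end
end

section
/- Let χ : C⊗D → D⊗C be a twist map satisfying condition (CO), and let Ψ : C⊗D → D⊗C be a twist map such that Ψ' := Ψ∘τ satisfies conditions (LC1) and (LC2). Then the composed twist map Ψ'∘χ : C⊗D → D⊗C also satisfies condition (CO). -/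
open TensorProduct LinearMap

noncomputable section
namespace TwistedTensor

variable {k : Type*} [Field k]
variable {C D : Type*} [AddCommGroup C] [Module k C] [AddCommGroup D] [Module k D]
  [Coalgebra k C] [Coalgebra k D]

/-- The twisted coproduct `Δ_Ψ := (id_C ⊗ Ψ ⊗ id_D) ∘ (Δ_C ⊗ Δ_D)` (with the
appropriate reassociations of tensor factors). -/
def twistedComul (Ψ : C ⊗[k] D →ₗ[k] D ⊗[k] C) :
    C ⊗[k] D →ₗ[k] (C ⊗[k] D) ⊗[k] (C ⊗[k] D) :=
  (TensorProduct.assoc k C D (C ⊗[k] D)).symm.toLinearMap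
    ∘ₗ lTensor C (TensorProduct.assoc k D C D).toLinearMap
    ∘ₗ lTensor C (rTensor D Ψ)
    ∘ₗ lTensor C (TensorProduct.assoc k C D D).symm.toLinearMap
    ∘ₗ (TensorProduct.assoc k C C (D ⊗[k] D)).toLinearMap
    ∘ₗ map (cmul k C) (cmul k D)

/-- Left-hand side of condition (CO):
`(id_D⊗id_C⊗Ψ)∘(id_D⊗Δ_C⊗id_D)∘(Ψ⊗id_D)∘(id_C⊗Δ_D)`. -/
def COlhs (Ψ : C ⊗[k] D →ₗ[k] D ⊗[k] C) :
    C ⊗[k] D →ₗ[k] D ⊗[k] (C ⊗[k] (D ⊗[k] C)) :=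
  lTensor D ((lTensor C Ψ) ∘ₗ (TensorProduct.assoc k C C D).toLinearMap)
    ∘ₗ lTensor D (rTensor D (cmul k C))
    ∘ₗ (TensorProduct.assoc k D C D).toLinearMap
    ∘ₗ rTensor D Ψ
    ∘ₗ (TensorProduct.assoc k C D D).symm.toLinearMap
    ∘ₗ lTensor C (cmul k D)

/-- Right-hand side of condition (CO):
`(Ψ⊗id_D⊗id_C)∘(id_C⊗Δ_D⊗id_C)∘(id_C⊗Ψ)∘(Δ_C⊗id_D)`. -/
def COrhs (Ψ : C ⊗[k] D →ₗ[k] D ⊗[k] C) :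
    C ⊗[k] D →ₗ[k] D ⊗[k] (C ⊗[k] (D ⊗[k] C)) :=
  (TensorProduct.assoc k D C (D ⊗[k] C)).toLinearMap
    ∘ₗ rTensor (D ⊗[k] C) Ψ
    ∘ₗ (TensorProduct.assoc k C D (D ⊗[k] C)).symm.toLinearMap
    ∘ₗ lTensor C (TensorProduct.assoc k D D C).toLinearMap
    ∘ₗ lTensor C (rTensor C (cmul k D))
    ∘ₗ lTensor C Ψ
    ∘ₗ (TensorProduct.assoc k C C D).toLinearMap
    ∘ₗ rTensor D (cmul k C)

/-- Condition (CO) on a twist map. -/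
def CondCO (Ψ : C ⊗[k] D →ₗ[k] D ⊗[k] C) : Prop := COlhs Ψ = COrhs Ψ

/-- `e` is a counit for the coproduct `δ` on `C ⊗ D`. -/
def IsCounit (δ : C ⊗[k] D →ₗ[k] (C ⊗[k] D) ⊗[k] (C ⊗[k] D))
    (e : C ⊗[k] D →ₗ[k] k) : Prop :=
  (TensorProduct.lid k (C ⊗[k] D)).toLinearMap ∘ₗ rTensor (C ⊗[k] D) e ∘ₗ δ = LinearMap.id ∧
  (TensorProduct.rid k (C ⊗[k] D)).toLinearMap ∘ₗ lTensor (C ⊗[k] D) e ∘ₗ δ = LinearMap.id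

/-- Right conormality: `(ε_D⊗id_C)∘Ψ = id_C⊗ε_D`. -/
def RightConormal (Ψ : C ⊗[k] D →ₗ[k] D ⊗[k] C) : Prop :=
  (TensorProduct.lid k C).toLinearMap ∘ₗ rTensor C (eps k D) ∘ₗ Ψ
    = (TensorProduct.rid k C).toLinearMap ∘ₗ lTensor C (eps k D)

/-- Left conormality: `(id_D⊗ε_C)∘Ψ = ε_C⊗id_D`. -/
def LeftConormal (Ψ : C ⊗[k] D →ₗ[k] D ⊗[k] C) : Prop :=
  (TensorProduct.rid k D).toLinearMap ∘ₗ lTensor D (eps k C) ∘ₗ Ψ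
    = (TensorProduct.lid k D).toLinearMap ∘ₗ rTensor D (eps k C)

/-- Conormality of a twist map. -/
def Conormal (Ψ : C ⊗[k] D →ₗ[k] D ⊗[k] C) : Prop :=
  RightConormal Ψ ∧ LeftConormal Ψ

/-- Condition (CP1): `(id_D⊗Ψ)∘(Ψ⊗id_D)∘(id_C⊗Δ_D) = (Δ_D⊗id_C)∘Ψ`. -/
def CP1 (Ψ : C ⊗[k] D →ₗ[k] D ⊗[k] C) : Prop :=
  lTensor D Ψ ∘ₗ (TensorProduct.assoc k D C D).toLinearMap ∘ₗ rTensor D Ψ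
      ∘ₗ (TensorProduct.assoc k C D D).symm.toLinearMap ∘ₗ lTensor C (cmul k D)
    = (TensorProduct.assoc k D D C).toLinearMap ∘ₗ rTensor C (cmul k D) ∘ₗ Ψ

/-- Condition (CP2): `(Ψ⊗id_C)∘(id_C⊗Ψ)∘(Δ_C⊗id_D) = (id_D⊗Δ_C)∘Ψ`. -/
def CP2 (Ψ : C ⊗[k] D →ₗ[k] D ⊗[k] C) : Prop :=
  (TensorProduct.assoc k D C C).toLinearMap ∘ₗ rTensor C Ψ
      ∘ₗ (TensorProduct.assoc k C D C).symm.toLinearMap ∘ₗ lTensor C Ψ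
      ∘ₗ (TensorProduct.assoc k C C D).toLinearMap ∘ₗ rTensor D (cmul k C)
    = lTensor D (cmul k C) ∘ₗ Ψ

/-- The functional `ε_Z := (ε_D⊗ε_C)∘Z`. -/
def epsZ (Z : C ⊗[k] D →ₗ[k] D ⊗[k] C) : C ⊗[k] D →ₗ[k] k :=
  (TensorProduct.lid k k).toLinearMap ∘ₗ map (eps k D) (eps k C) ∘ₗ Z

/-- Right `Z`-conormality: `(ε_Z⊗id_C)∘(id_C⊗Ψ)∘(Δ_C⊗id_D) = id_C⊗ε_D`. -/
def RightZConormal (Ψ Z : C ⊗[k] D →ₗ[k] D ⊗[k] C) : Prop :=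
  (TensorProduct.lid k C).toLinearMap ∘ₗ rTensor C (epsZ Z)
      ∘ₗ (TensorProduct.assoc k C D C).symm.toLinearMap ∘ₗ lTensor C Ψ
      ∘ₗ (TensorProduct.assoc k C C D).toLinearMap ∘ₗ rTensor D (cmul k C)
    = (TensorProduct.rid k C).toLinearMap ∘ₗ lTensor C (eps k D)

/-- Left `Z`-conormality: `(id_D⊗ε_Z)∘(Ψ⊗id_D)∘(id_C⊗Δ_D) = ε_C⊗id_D`. -/
def LeftZConormal (Ψ Z : C ⊗[k] D →ₗ[k] D ⊗[k] C) : Prop :=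
  (TensorProduct.rid k D).toLinearMap ∘ₗ lTensor D (epsZ Z)
      ∘ₗ (TensorProduct.assoc k D C D).toLinearMap ∘ₗ rTensor D Ψ
      ∘ₗ (TensorProduct.assoc k C D D).symm.toLinearMap ∘ₗ lTensor C (cmul k D)
    = (TensorProduct.lid k D).toLinearMap ∘ₗ rTensor D (eps k C)

/-- `Z`-conormality. -/
def ZConormal (Ψ Z : C ⊗[k] D →ₗ[k] D ⊗[k] C) : Prop :=
  RightZConormal Ψ Z ∧ LeftZConormal Ψ Z

/-- The projection `p_C := (id_C⊗e)∘(Δ_C⊗id_D)`. -/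
def pC (e : C ⊗[k] D →ₗ[k] k) : C ⊗[k] D →ₗ[k] C :=
  (TensorProduct.rid k C).toLinearMap ∘ₗ lTensor C e
    ∘ₗ (TensorProduct.assoc k C C D).toLinearMap ∘ₗ rTensor D (cmul k C)

/-- The projection `p_D := (e⊗id_D)∘(id_C⊗Δ_D)`. -/
def pD (e : C ⊗[k] D →ₗ[k] k) : C ⊗[k] D →ₗ[k] D :=
  (TensorProduct.lid k D).toLinearMap ∘ₗ rTensor D e
    ∘ₗ (TensorProduct.assoc k C D D).symm.toLinearMap ∘ₗ lTensor C (cmul k D)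

/-- The projection `π_C = id_C ⊗ ε_D`. -/
def piC : C ⊗[k] D →ₗ[k] C :=
  (TensorProduct.rid k C).toLinearMap ∘ₗ lTensor C (eps k D)

/-- The projection `π_D = ε_C ⊗ id_D`. -/
def piD : C ⊗[k] D →ₗ[k] D :=
  (TensorProduct.lid k D).toLinearMap ∘ₗ rTensor D (eps k C)

/-- `⋆`-product on `(C⊗D)'`: `(φ⋆φ')(c⊗d) = φ(c₂⊗d₁)φ'(c₁⊗d₂)`. -/
def starMul (φ φ' : C ⊗[k] D →ₗ[k] k) : C ⊗[k] D →ₗ[k] k :=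
  (TensorProduct.lid k k).toLinearMap ∘ₗ map φ φ'
    ∘ₗ (tensorTensorTensorComm k C C D D).toLinearMap
    ∘ₗ rTensor (D ⊗[k] D) (TensorProduct.comm k C C).toLinearMap
    ∘ₗ map (cmul k C) (cmul k D)

/-- Condition (LC1): `(Δ_D⊗id_C)∘Ψ' = (id_D⊗Ψ')∘(Δ_D⊗id_C)`. -/
def LC1 (Ψ' : D ⊗[k] C →ₗ[k] D ⊗[k] C) : Prop :=
  (TensorProduct.assoc k D D C).toLinearMap ∘ₗ rTensor C (cmul k D) ∘ₗ Ψ'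
    = lTensor D Ψ' ∘ₗ (TensorProduct.assoc k D D C).toLinearMap ∘ₗ rTensor C (cmul k D)

/-- Condition (LC2): `(id_D⊗Δ_C)∘Ψ' = (Ψ'⊗id_C)∘(id_D⊗Δ_C)`. -/
def LC2 (Ψ' : D ⊗[k] C →ₗ[k] D ⊗[k] C) : Prop :=
  lTensor D (cmul k C) ∘ₗ Ψ'
    = (TensorProduct.assoc k D C C).toLinearMap ∘ₗ rTensor C Ψ'
        ∘ₗ (TensorProduct.assoc k D C C).symm.toLinearMap ∘ₗ lTensor D (cmul k C)

/-- `Ψ' := Ψ ∘ τ`. -/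
def psiPrime (Ψ : C ⊗[k] D →ₗ[k] D ⊗[k] C) : D ⊗[k] C →ₗ[k] D ⊗[k] C :=
  Ψ ∘ₗ (TensorProduct.comm k D C).toLinearMap

/-- The twist `Ψ'_φ : d⊗c ↦ φ(c₁⊗d₂) d₁⊗c₂` associated to a functional `φ`. -/
def PsiPhi (φ : C ⊗[k] D →ₗ[k] k) : D ⊗[k] C →ₗ[k] D ⊗[k] C :=
  (TensorProduct.rid k (D ⊗[k] C)).toLinearMap
    ∘ₗ lTensor (D ⊗[k] C) φ
    ∘ₗ lTensor (D ⊗[k] C) (TensorProduct.comm k D C).toLinearMap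
    ∘ₗ (tensorTensorTensorComm k D D C C).toLinearMap
    ∘ₗ lTensor (D ⊗[k] D) (TensorProduct.comm k C C).toLinearMap
    ∘ₗ map (cmul k D) (cmul k C)

/-- The functional `F(Ψ') := (ε_D⊗ε_C)∘Ψ'∘τ` associated to a twist `Ψ' : D⊗C → D⊗C`. -/
def Ffun (Ψ' : D ⊗[k] C →ₗ[k] D ⊗[k] C) : C ⊗[k] D →ₗ[k] k :=
  (TensorProduct.lid k k).toLinearMap ∘ₗ map (eps k D) (eps k C) ∘ₗ Ψ'
    ∘ₗ (TensorProduct.comm k C D).toLinearMap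

/-- The tensor product coproduct `Δ_⊗` on `C ⊗ D`. -/
def tensorComul : C ⊗[k] D →ₗ[k] (C ⊗[k] D) ⊗[k] (C ⊗[k] D) :=
  (tensorTensorTensorComm k C C D D).toLinearMap ∘ₗ map (cmul k C) (cmul k D)

/-- The map `id_C ⊗ Ψ' ⊗ id_D : (C⊗D)⊗(C⊗D) → (C⊗D)⊗(C⊗D)`. -/
def midMap (Ψ' : D ⊗[k] C →ₗ[k] D ⊗[k] C) :
    (C ⊗[k] D) ⊗[k] (C ⊗[k] D) →ₗ[k] (C ⊗[k] D) ⊗[k] (C ⊗[k] D) :=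
  (TensorProduct.assoc k C D (C ⊗[k] D)).symm.toLinearMap
    ∘ₗ lTensor C ((TensorProduct.assoc k D C D).toLinearMap ∘ₗ rTensor D Ψ'
        ∘ₗ (TensorProduct.assoc k D C D).symm.toLinearMap)
    ∘ₗ (TensorProduct.assoc k C D (C ⊗[k] D)).toLinearMap

/-- `C` is co-commutative up to isomorphism: there is a coalgebra isomorphism `C ≅ C^cop`. -/
def CocommUpToIso (k C : Type*) [CommSemiring k] [AddCommMonoid C] [Module k C]
    [Coalgebra k C] : Prop :=
  ∃ χ : C →ₗ[k] C, Function.Bijective χ ∧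
    map χ χ ∘ₗ cmul k C = (TensorProduct.comm k C C).toLinearMap ∘ₗ cmul k C ∘ₗ χ ∧
    eps k C ∘ₗ χ = eps k C

/-- The map `P ⊗ P`, transported along the reassociation of the tensor factors. -/
def mapTwice (P : D ⊗[k] C →ₗ[k] D ⊗[k] C) :
    D ⊗[k] (C ⊗[k] (D ⊗[k] C)) →ₗ[k] D ⊗[k] (C ⊗[k] (D ⊗[k] C)) :=
  (TensorProduct.assoc k D C (D ⊗[k] C)).toLinearMap ∘ₗ map P P
    ∘ₗ (TensorProduct.assoc k D C (D ⊗[k] C)).symm.toLinearMap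

lemma lTensor_comul_assoc_tmul {M N : Type*} [AddCommGroup M] [Module k M] [AddCommGroup N]
    [Module k N] [Coalgebra k M]
    (f : M ⊗[k] N →ₗ[k] N ⊗[k] M) (v : N ⊗[k] M) (d : N) :
    lTensor N ((lTensor M f) ∘ₗ (TensorProduct.assoc k M M N).toLinearMap)
        (lTensor N (rTensor N (cmul k M)) (TensorProduct.assoc k N M N (v ⊗ₜ d)))
      = lTensor N (lTensor M (f ∘ₗ (TensorProduct.mk k M N).flip d))
          (lTensor N (cmul k M) v) := by
  induction v with
  | zero => simp
  | add x y hx hy => simp only [add_tmul, map_add, hx, hy]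
  | tmul a c =>
    simp only [TensorProduct.assoc_tmul, lTensor_tmul, rTensor_tmul, coe_comp,
      Function.comp_apply, LinearEquiv.coe_coe]
    congr 1
    induction cmul k M c with
    | zero => simp
    | add x y hx hy => simp only [add_tmul, map_add, hx, hy]
    | tmul x y => simp

lemma lTensor_comp_assoc_rTensor {M N : Type*} [AddCommGroup M] [Module k M] [AddCommGroup N]
    [Module k N]
    (P : N ⊗[k] M →ₗ[k] N ⊗[k] M) (g : M →ₗ[k] N ⊗[k] M)
    (w : N ⊗[k] (M ⊗[k] M)) :
    lTensor N (lTensor M (P ∘ₗ g)) (TensorProduct.assoc k N M M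
        (rTensor M P ((TensorProduct.assoc k N M M).symm w)))
      = mapTwice P (lTensor N (lTensor M g) w) := by
  obtain ⟨w, rfl⟩ := (TensorProduct.assoc k N M M).surjective w
  rw [LinearEquiv.symm_apply_apply]
  induction w with
  | zero => simp
  | add x y hx hy => simp only [map_add, hx, hy]
  | tmul u c =>
    have key : ∀ (h : M →ₗ[k] N ⊗[k] M) (v : N ⊗[k] M),
        lTensor N (lTensor M h) (TensorProduct.assoc k N M M (v ⊗ₜ c))
          = TensorProduct.assoc k N M (N ⊗[k] M) (v ⊗ₜ h c) := by
      intro h v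
      induction v with
      | zero => simp
      | add x y hx hy => simp only [add_tmul, map_add, hx, hy]
      | tmul a b => simp
    simp [key, mapTwice]

lemma COlhs_comp (P : D ⊗[k] C →ₗ[k] D ⊗[k] C) (hP : LC2 P) (χ : C ⊗[k] D →ₗ[k] D ⊗[k] C) :
    COlhs (P ∘ₗ χ) = mapTwice P ∘ₗ COlhs χ := by
  have key : ∀ x : (D ⊗[k] C) ⊗[k] D,
      lTensor D ((lTensor C (P ∘ₗ χ)) ∘ₗ (TensorProduct.assoc k C C D).toLinearMap)
          (lTensor D (rTensor D (cmul k C)) (TensorProduct.assoc k D C D (rTensor D P x)))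
        = mapTwice P (lTensor D ((lTensor C χ) ∘ₗ (TensorProduct.assoc k C C D).toLinearMap)
          (lTensor D (rTensor D (cmul k C)) (TensorProduct.assoc k D C D x))) := by
    intro x
    induction x with
    | zero => simp
    | add x y hx hy => simp only [map_add, hx, hy]
    | tmul u d =>
      have h := LinearMap.congr_fun hP u
      simp only [coe_comp, Function.comp_apply, LinearEquiv.coe_coe] at h
      rw [rTensor_tmul, lTensor_comul_assoc_tmul, lTensor_comul_assoc_tmul, h,
        LinearMap.comp_assoc, lTensor_comp_assoc_rTensor]
  ext1
  ext c d
  have := key (rTensor D χ ((TensorProduct.assoc k C D D).symm (c ⊗ₜ cmul k D d)))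
  rw [← rTensor_comp_apply] at this
  exact this

lemma rTensor_assoc_symm_tmul {M N : Type*} [AddCommGroup M] [Module k M] [AddCommGroup N]
    [Module k N]
    (f : M ⊗[k] N →ₗ[k] N ⊗[k] M) (c : M)
    (z : N ⊗[k] (N ⊗[k] M)) :
    rTensor (N ⊗[k] M) f ((TensorProduct.assoc k M N (N ⊗[k] M)).symm (c ⊗ₜ z))
      = rTensor (N ⊗[k] M) (f ∘ₗ TensorProduct.mk k M N c) z := by
  induction z with
  | zero => simp
  | add x y hx hy => simp only [tmul_add, map_add, hx, hy]
  | tmul a b => simp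

lemma assoc_rTensor_comp_lTensor {M N : Type*} [AddCommGroup M] [Module k M] [AddCommGroup N]
    [Module k N]
    (P : N ⊗[k] M →ₗ[k] N ⊗[k] M) (g : N →ₗ[k] N ⊗[k] M)
    (z : N ⊗[k] (N ⊗[k] M)) :
    TensorProduct.assoc k N M (N ⊗[k] M) (rTensor (N ⊗[k] M) (P ∘ₗ g) (lTensor N P z))
      = mapTwice P (TensorProduct.assoc k N M (N ⊗[k] M) (rTensor (N ⊗[k] M) g z)) := by
  induction z with
  | zero => simp
  | add x y hx hy => simp only [map_add, hx, hy]
  | tmul a b => simp [mapTwice]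

lemma COrhs_comp (P : D ⊗[k] C →ₗ[k] D ⊗[k] C) (hP : LC1 P) (χ : C ⊗[k] D →ₗ[k] D ⊗[k] C) :
    COrhs (P ∘ₗ χ) = mapTwice P ∘ₗ COrhs χ := by
  have key : ∀ y : C ⊗[k] (D ⊗[k] C),
      TensorProduct.assoc k D C (D ⊗[k] C) (rTensor (D ⊗[k] C) (P ∘ₗ χ)
          ((TensorProduct.assoc k C D (D ⊗[k] C)).symm
            (lTensor C (TensorProduct.assoc k D D C).toLinearMap
              (lTensor C (rTensor C (cmul k D)) (lTensor C P y)))))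
        = mapTwice P (TensorProduct.assoc k D C (D ⊗[k] C) (rTensor (D ⊗[k] C) χ
          ((TensorProduct.assoc k C D (D ⊗[k] C)).symm
            (lTensor C (TensorProduct.assoc k D D C).toLinearMap
              (lTensor C (rTensor C (cmul k D)) y))))) := by
    intro y
    induction y with
    | zero => simp
    | add x y hx hy => simp only [map_add, hx, hy]
    | tmul c u =>
      have h := LinearMap.congr_fun hP u
      simp only [coe_comp, Function.comp_apply, LinearEquiv.coe_coe] at h
      simp only [lTensor_tmul, LinearEquiv.coe_coe]
      rw [h, rTensor_assoc_symm_tmul, rTensor_assoc_symm_tmul,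
        LinearMap.comp_assoc, assoc_rTensor_comp_lTensor]
  ext1
  ext c d
  have := key (lTensor C χ (TensorProduct.assoc k C C D (cmul k C c ⊗ₜ d)))
  rw [← lTensor_comp_apply C P χ] at this
  exact this

theorem stmt17 (χ Ψ : C ⊗[k] D →ₗ[k] D ⊗[k] C) (hχ : CondCO χ)
    (h1 : LC1 (psiPrime Ψ)) (h2 : LC2 (psiPrime Ψ)) :
    CondCO (psiPrime Ψ ∘ₗ χ) := by
  rw [CondCO, COlhs_comp _ h2, COrhs_comp _ h1, show COlhs χ = COrhs χ from hχ]

end TwistedTensor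
end
end

section
/- Let A and B be associative unital k-algebras and ψ : B⊗A → A⊗B a k-linear map. The twisted multiplication m_ψ := (m_A⊗m_B)∘(id_A⊗ψ⊗id_B) : (A⊗B)⊗(A⊗B) → A⊗B is associative, i.e. m_ψ∘(m_ψ⊗id_{A⊗B}) = m_ψ∘(id_{A⊗B}⊗m_ψ), if and only if ψ satisfies condition (O). -/
open TensorProduct LinearMap

noncomputable section
namespace TwistedTensor

variable {k : Type*} [Field k]
variable {A B : Type*} [Ring A] [Algebra k A] [Ring B] [Algebra k B]

/-- The twisted multiplication `m_ψ := (m_A⊗m_B)∘(id_A⊗ψ⊗id_B)` (with the appropriate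
reassociations of tensor factors). -/
def twistedMul (ψ : B ⊗[k] A →ₗ[k] A ⊗[k] B) :
    (A ⊗[k] B) ⊗[k] (A ⊗[k] B) →ₗ[k] A ⊗[k] B :=
  map (LinearMap.mul' k A) (LinearMap.mul' k B)
    ∘ₗ (TensorProduct.assoc k A A (B ⊗[k] B)).symm.toLinearMap
    ∘ₗ lTensor A (TensorProduct.assoc k A B B).toLinearMap
    ∘ₗ lTensor A (rTensor B ψ)
    ∘ₗ lTensor A (TensorProduct.assoc k B A B).symm.toLinearMap
    ∘ₗ (TensorProduct.assoc k A B (A ⊗[k] B)).toLinearMap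

/-- Left-hand side of condition (O):
`(id_A⊗m_B)∘(ψ⊗id_B)∘(id_B⊗m_A⊗id_B)∘(id_B⊗id_A⊗ψ)`. -/
def Olhs (ψ : B ⊗[k] A →ₗ[k] A ⊗[k] B) :
    B ⊗[k] (A ⊗[k] (B ⊗[k] A)) →ₗ[k] A ⊗[k] B :=
  lTensor A (LinearMap.mul' k B)
    ∘ₗ (TensorProduct.assoc k A B B).toLinearMap
    ∘ₗ rTensor B ψ
    ∘ₗ (TensorProduct.assoc k B A B).symm.toLinearMap
    ∘ₗ lTensor B (rTensor B (LinearMap.mul' k A)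
        ∘ₗ (TensorProduct.assoc k A A B).symm.toLinearMap)
    ∘ₗ lTensor B (lTensor A ψ)

/-- Right-hand side of condition (O):
`(m_A⊗id_B)∘(id_A⊗ψ)∘(id_A⊗m_B⊗id_A)∘(ψ⊗id_B⊗id_A)`. -/
def Orhs (ψ : B ⊗[k] A →ₗ[k] A ⊗[k] B) :
    B ⊗[k] (A ⊗[k] (B ⊗[k] A)) →ₗ[k] A ⊗[k] B :=
  rTensor B (LinearMap.mul' k A)
    ∘ₗ (TensorProduct.assoc k A A B).symm.toLinearMap
    ∘ₗ lTensor A ψ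
    ∘ₗ lTensor A (rTensor A (LinearMap.mul' k B))
    ∘ₗ lTensor A (TensorProduct.assoc k B B A).symm.toLinearMap
    ∘ₗ (TensorProduct.assoc k A B (B ⊗[k] A)).toLinearMap
    ∘ₗ rTensor (B ⊗[k] A) ψ
    ∘ₗ (TensorProduct.assoc k B A (B ⊗[k] A)).symm.toLinearMap

/-- Condition (O) on a twist map. -/
def CondO (ψ : B ⊗[k] A →ₗ[k] A ⊗[k] B) : Prop := Olhs ψ = Orhs ψ

theorem twistedMul_tmul (ψ : B ⊗[k] A →ₗ[k] A ⊗[k] B) (a c : A) (b d : B) :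
    twistedMul ψ ((a ⊗ₜ b) ⊗ₜ (c ⊗ₜ d)) = map (mulLeft k a) (mulRight k d) (ψ (b ⊗ₜ c)) := by
  simp only [twistedMul, comp_apply, LinearEquiv.coe_coe, assoc_tmul, lTensor_tmul,
    assoc_symm_tmul, rTensor_tmul]
  induction ψ (b ⊗ₜ c) with
  | zero => simp
  | tmul x y => simp
  | add x y hx hy => simp only [map_add, add_tmul, tmul_add, hx, hy]

/-- Products with three pure factors, bracketed to the left, are computed by `Orhs`. -/
theorem twistedMul_twistedMul_tmul (ψ : B ⊗[k] A →ₗ[k] A ⊗[k] B) (a c e : A) (b d f : B) :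
    twistedMul ψ (twistedMul ψ ((a ⊗ₜ b) ⊗ₜ (c ⊗ₜ d)) ⊗ₜ (e ⊗ₜ f)) =
      map (mulLeft k a) (mulRight k f) (Orhs ψ (b ⊗ₜ (c ⊗ₜ (d ⊗ₜ e)))) := by
  rw [twistedMul_tmul]
  simp only [Orhs, comp_apply, LinearEquiv.coe_coe, assoc_symm_tmul, rTensor_tmul]
  induction ψ (b ⊗ₜ c) with
  | zero => simp
  | add x y hx hy => simp only [map_add, add_tmul, hx, hy]
  | tmul x y =>
    simp only [map_tmul, mulLeft_apply, mulRight_apply, twistedMul_tmul, assoc_tmul,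
      lTensor_tmul, LinearEquiv.coe_coe, assoc_symm_tmul, rTensor_tmul, mul'_apply]
    induction ψ ((y * d) ⊗ₜ e) with
    | zero => simp
    | add u v hu hv => simp only [map_add, tmul_add, hu, hv]
    | tmul u v => simp

/-- Products with three pure factors, bracketed to the right, are computed by `Olhs`. -/
theorem twistedMul_tmul_twistedMul (ψ : B ⊗[k] A →ₗ[k] A ⊗[k] B) (a c e : A) (b d f : B) :
    twistedMul ψ ((a ⊗ₜ b) ⊗ₜ twistedMul ψ ((c ⊗ₜ d) ⊗ₜ (e ⊗ₜ f))) =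
      map (mulLeft k a) (mulRight k f) (Olhs ψ (b ⊗ₜ (c ⊗ₜ (d ⊗ₜ e)))) := by
  rw [twistedMul_tmul]
  simp only [Olhs, comp_apply, LinearEquiv.coe_coe, lTensor_tmul]
  induction ψ (d ⊗ₜ e) with
  | zero => simp
  | add x y hx hy => simp only [map_add, tmul_add, hx, hy]
  | tmul x y =>
    simp only [map_tmul, mulLeft_apply, mulRight_apply, twistedMul_tmul,
      assoc_symm_tmul, rTensor_tmul, mul'_apply]
    induction ψ (b ⊗ₜ (c * x)) with
    | zero => simp
    | add u v hu hv => simp only [map_add, add_tmul, hu, hv]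
    | tmul u v => simp [mul_assoc]

theorem stmt19 (ψ : B ⊗[k] A →ₗ[k] A ⊗[k] B) :
    (twistedMul ψ ∘ₗ rTensor (A ⊗[k] B) (twistedMul ψ)
      = twistedMul ψ ∘ₗ lTensor (A ⊗[k] B) (twistedMul ψ)
          ∘ₗ (TensorProduct.assoc k (A ⊗[k] B) (A ⊗[k] B) (A ⊗[k] B)).toLinearMap)
    ↔ CondO ψ := by
  refine ⟨fun h => ?_, fun h => ?_⟩
  · refine TensorProduct.ext' fun b x => ?_
    induction x with
    | zero => simp
    | add x y hx hy => simp only [map_add, tmul_add, hx, hy]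
    | tmul c y =>
      induction y with
      | zero => simp
      | add x y hx hy => simp only [map_add, tmul_add, hx, hy]
      | tmul d e =>
        have key := LinearMap.congr_fun h (((1 ⊗ₜ b) ⊗ₜ (c ⊗ₜ d)) ⊗ₜ (e ⊗ₜ 1))
        simp only [comp_apply, LinearEquiv.coe_coe, rTensor_tmul, assoc_tmul, lTensor_tmul,
          twistedMul_twistedMul_tmul, twistedMul_tmul_twistedMul, mulLeft_one, mulRight_one,
          map_id, id_apply] at key
        exact key.symm
  · have key : Olhs ψ = Orhs ψ := h
    ext a b c d e f
    simp [twistedMul_twistedMul_tmul, twistedMul_tmul_twistedMul, key]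

end TwistedTensor
end
end
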